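/- Consider the planar system (†) obtained by central projection at (0,0,−1) of a degree-2 homogeneous polynomial vector field on S² in normal form (★) with a₃ = a₆ = 0. If a₄ = a₅ = a₇ = a₈ = 0 (so the linearization of (†) at the origin is the zero matrix), then (0,0) is not a center of (†). In this case the system (★) reduces to ẋ = y(a₁x+a₂y), ẏ = −x(a₁x+a₂y), ż = 0. -/

import Mathlib

/-- The planar system (†) obtained by central projection at `(0,0,-1)` of the normal form (★)
with `a₃ = a₆ = 0`. -/
def sysDagger (a1 a2 a4 a5 a7 a8 : ℝ) : ℝ × ℝ → ℝ × ℝ := fun w =>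
  (-a4 * w.1 - a5 * w.2 + a1 * w.1 * w.2 + a2 * w.2 ^ 2 - a4 * w.1 ^ 3
      - (a5 + a7) * w.1 ^ 2 * w.2 - a8 * w.1 * w.2 ^ 2,
   -a7 * w.1 - a8 * w.2 - a1 * w.1 ^ 2 - a2 * w.1 * w.2 - a4 * w.1 ^ 2 * w.2
      - (a5 + a7) * w.1 * w.2 ^ 2 - a8 * w.2 ^ 3)

/-- A singular point `q` of a planar vector field `f` is a center if it has a punctured
neighborhood in which every orbit is a (nonconstant) periodic orbit surrounding `q`
(i.e. `q` lies in a bounded component of the complement of the orbit). -/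
def IsCenter (f : ℝ × ℝ → ℝ × ℝ) (q : ℝ × ℝ) : Prop :=
  f q = 0 ∧ ∃ U ∈ nhds q, ∀ p ∈ U, p ≠ q →
    ∃ (γ : ℝ → ℝ × ℝ) (T : ℝ),
      γ 0 = p ∧ (∀ t, HasDerivAt γ (f (γ t)) t) ∧ 0 < T ∧ (∀ t, γ (t + T) = γ t) ∧
      (¬ ∀ t, γ t = γ 0) ∧ q ∉ Set.range γ ∧
      Bornology.IsBounded (connectedComponentIn (Set.range γ)ᶜ q)

/-- The components of the normal form (★). -/
def starP (a1 a2 a3 a4 a5 : ℝ) (x y z : ℝ) : ℝ :=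
  a1 * x * y + a2 * y ^ 2 + a3 * z ^ 2 + a4 * x * z + a5 * y * z

def starQ (a1 a2 a6 a7 a8 : ℝ) (x y z : ℝ) : ℝ :=
  -a1 * x ^ 2 - a2 * x * y + a6 * z ^ 2 + a7 * x * z + a8 * y * z

def starR (a3 a4 a5 a6 a7 a8 : ℝ) (x y z : ℝ) : ℝ :=
  -a4 * x ^ 2 - a8 * y ^ 2 - (a5 + a7) * x * y - a3 * x * z - a6 * y * z

open Filter Topology in
/-- A nonzero vector has arbitrarily small nonzero multiples. -/
theorem exists_smul_mem_of_mem_nhds_zero {d : ℝ × ℝ} (hd : d ≠ 0) {U : Set (ℝ × ℝ)}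
    (hU : U ∈ 𝓝 (0 : ℝ × ℝ)) : ∃ r : ℝ, r • d ∈ U ∧ r • d ≠ 0 := by
  have hlim : Tendsto (fun r : ℝ => r • d) (𝓝[≠] 0) (𝓝 0) := by
    have h : Continuous fun r : ℝ => r • d := by fun_prop
    simpa using (h.tendsto 0).mono_left nhdsWithin_le_nhds
  obtain ⟨r, hr, hr0⟩ := ((hlim.eventually hU).and self_mem_nhdsWithin).exists
  exact ⟨r, hr, smul_ne_zero hr0 hd⟩

/-- A solution of a scalar linear equation with continuous coefficient that vanishes at `0`
vanishes identically. -/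
theorem eq_zero_of_hasDerivAt_mul {c g : ℝ → ℝ} (hc : Continuous c)
    (hg : ∀ t, HasDerivAt g (c t * g t) t) (h0 : g 0 = 0) (t : ℝ) : g t = 0 := by
  have hC (s : ℝ) : HasDerivAt (fun s => ∫ x in (0 : ℝ)..s, c x) (c s) s :=
    intervalIntegral.integral_hasDerivAt_right (hc.intervalIntegrable _ _)
      (hc.stronglyMeasurableAtFilter _ _) hc.continuousAt
  have hF (s : ℝ) :
      HasDerivAt (fun s => g s * Real.exp (-∫ x in (0 : ℝ)..s, c x)) 0 s := by
    refine ((hg s).mul (hC s).neg.exp).congr_deriv ?_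
    ring
  have h := is_const_of_deriv_eq_zero (fun s => (hF s).differentiableAt)
    (fun s => (hF s).deriv) t 0
  simpa [h0, Real.exp_ne_zero] using h

/-- The line `a₁u + a₂v = 0` consists of equilibria of the linearly zero system, and the
solutions starting on it are constant. -/
theorem sysDagger_linearlyZero_solution_const {a1 a2 : ℝ} {γ : ℝ → ℝ × ℝ}
    (hγ : ∀ t, HasDerivAt γ (sysDagger a1 a2 0 0 0 0 (γ t)) t)
    (h0 : a1 * (γ 0).1 + a2 * (γ 0).2 = 0) (t : ℝ) : γ t = γ 0 := by
  have hcont : Continuous γ := continuous_iff_continuousAt.2 fun s => (hγ s).continuousAt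
  have hline : ∀ s, a1 * (γ s).1 + a2 * (γ s).2 = 0 := by
    refine eq_zero_of_hasDerivAt_mul (c := fun s => a1 * (γ s).2 - a2 * (γ s).1)
      (by fun_prop) (fun s => ?_) h0
    have hu : HasDerivAt (fun s => (γ s).1) (sysDagger a1 a2 0 0 0 0 (γ s)).1 s :=
      (ContinuousLinearMap.fst ℝ ℝ ℝ).hasFDerivAt.comp_hasDerivAt s (hγ s)
    have hv : HasDerivAt (fun s => (γ s).2) (sysDagger a1 a2 0 0 0 0 (γ s)).2 s :=
      (ContinuousLinearMap.snd ℝ ℝ ℝ).hasFDerivAt.comp_hasDerivAt s (hγ s)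
    refine ((hu.const_mul a1).add (hv.const_mul a2)).congr_deriv ?_
    simp only [sysDagger]
    ring
  have hzero (s : ℝ) : sysDagger a1 a2 0 0 0 0 (γ s) = 0 := by
    ext
    · simp only [sysDagger, Prod.fst_zero]
      linear_combination (γ s).2 * hline s
    · simp only [sysDagger, Prod.snd_zero]
      linear_combination -(γ s).1 * hline s
  exact is_const_of_deriv_eq_zero (fun s => (hγ s).differentiableAt)
    (fun s => (hγ s).deriv.trans (hzero s)) t 0

/-- If `a₄ = a₅ = a₇ = a₈ = 0` (linearly zero singularity of (†)), then the
origin is not a center of (†); in this case (★) (with `a₃ = a₆ = 0`) reduces to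
`ẋ = y(a₁x+a₂y)`, `ẏ = -x(a₁x+a₂y)`, `ż = 0`. -/
theorem stmt5 (a1 a2 a4 a5 a7 a8 : ℝ)
    (h4 : a4 = 0) (h5 : a5 = 0) (h7 : a7 = 0) (h8 : a8 = 0) :
    ¬ IsCenter (sysDagger a1 a2 a4 a5 a7 a8) (0, 0) ∧
    (∀ x y z : ℝ,
      starP a1 a2 0 a4 a5 x y z = y * (a1 * x + a2 * y) ∧
      starQ a1 a2 0 a7 a8 x y z = -x * (a1 * x + a2 * y) ∧
      starR 0 a4 a5 0 a7 a8 x y z = 0) := by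
  subst h4 h5 h7 h8
  refine ⟨?_, fun x y z => ⟨?_, ?_, ?_⟩⟩
  · rintro ⟨-, U, hU, hper⟩
    obtain ⟨d, hd, hd_line⟩ : ∃ d : ℝ × ℝ, d ≠ 0 ∧ a1 * d.1 + a2 * d.2 = 0 := by
      by_cases h : a1 = 0 ∧ a2 = 0
      · exact ⟨(1, 0), by simp, by simp [h.1]⟩
      · exact ⟨(-a2, a1), fun hd => h (by simpa [and_comm] using hd), by ring⟩
    obtain ⟨r, hrU, hr0⟩ := exists_smul_mem_of_mem_nhds_zero hd hU
    obtain ⟨γ, -, hγ0, hγ, -, -, hnonconst, -, -⟩ := hper (r • d) hrU hr0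
    refine hnonconst (sysDagger_linearlyZero_solution_const hγ ?_)
    rw [hγ0, Prod.smul_fst, Prod.smul_snd, smul_eq_mul, smul_eq_mul]
    linear_combination r * hd_line
  · simp only [starP]
    ring
  · simp only [starQ]
    ring
  · simp only [starR]
    ring
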